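/- Suppose k ≥ 2 and S is an optimal assignment map. Let h ≠ j ∈ {1,…,ℓ} with n_j ≤ n_h, and let s, s* ∈ {1,…,k} with s* ≠ s, S(h) = s*, and m(b_s) ≥ n_j. If ‖y_j − y_h‖ + (ρ_α(n_h + n_j, n_j)/ρ_α(m(b_{s*}), n_j))·‖y_h − x_{s*}‖ < ρ_α(m(b_s), n_j)·‖y_j − x_s‖, then S(j) ≠ s. (Note m(b_{s*}) ≥ n_h ≥ n_j since S(h) = s*, so all occurrences of ρ_α are defined.) -/

import Mathlib

open scoped BigOperators RealInnerProductSpace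

noncomputable section

attribute [local instance] Classical.propDecidable

/-- Points of the ambient Euclidean space `ℝ^m`. -/
abbrev Pt (m : ℕ) := EuclideanSpace ℝ (Fin m)

/-- A weighted directed graph in `ℝ^m`: a finite vertex set, a finite set of
directed edges (ordered pairs of points, viewed as directed line segments), and
a weight function. -/
structure WDG (m : ℕ) where
  V : Finset (Pt m)
  E : Finset (Pt m × Pt m)
  w : Pt m × Pt m → ℝ

namespace WDG

variable {m : ℕ}

/-- Edges join distinct vertices of the graph and carry positive weight. -/
def edgesOK (G : WDG m) : Prop :=
  ∀ e ∈ G.E, e.1 ∈ G.V ∧ e.2 ∈ G.V ∧ e.1 ≠ e.2 ∧ 0 < G.w e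

/-- The underlying undirected (simple) graph. -/
def undirected (G : WDG m) : SimpleGraph (Pt m) :=
  SimpleGraph.fromRel (fun u v => (u, v) ∈ G.E)

/-- The cost `M_α(G) = Σ_{e ∈ E(G)} w(e)^α · length(e)`. -/
def cost (α : ℝ) (G : WDG m) : ℝ :=
  ∑ e ∈ G.E, (G.w e) ^ α * dist e.1 e.2

/-- Total weight of edges starting at `v`. -/
def outflow (G : WDG m) (v : Pt m) : ℝ :=
  ∑ e ∈ G.E.filter (fun e => e.1 = v), G.w e

/-- Total weight of edges ending at `v`. -/
def inflow (G : WDG m) (v : Pt m) : ℝ :=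
  ∑ e ∈ G.E.filter (fun e => e.2 = v), G.w e

end WDG

/-- Atomic measures are represented as finitely supported functions `ℝ^m →₀ ℝ`
with nonnegative values; `AtomicOn X c` also requires the atoms to lie in `X`. -/
def AtomicOn {m : ℕ} (X : Set (Pt m)) (c : Pt m →₀ ℝ) : Prop :=
  (∀ z, 0 ≤ c z) ∧ ↑c.support ⊆ X

/-- The mass `m(c)` of an atomic measure. -/
def massOf {m : ℕ} (c : Pt m →₀ ℝ) : ℝ := c.sum fun _ t => t

/-- `G` is a transport path from `a` to `b` inside `X`: its vertices lie in `X`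
and contain the atoms of `a` and `b`, its underlying undirected graph has no
cycles, and the balance equation holds at every vertex. -/
def IsTransportPath {m : ℕ} (X : Set (Pt m)) (G : WDG m) (a b : Pt m →₀ ℝ) : Prop :=
  G.edgesOK ∧ ↑G.V ⊆ X ∧
  (∀ z ∈ a.support, z ∈ G.V) ∧ (∀ z ∈ b.support, z ∈ G.V) ∧
  G.undirected.IsAcyclic ∧
  ∀ v : Pt m, G.outflow v - G.inflow v = a v - b v

/-- `d_α(a,b)`: the minimal cost of a transport path from `a` to `b`. -/
def dCost {m : ℕ} (X : Set (Pt m)) (α : ℝ) (a b : Pt m →₀ ℝ) : ℝ :=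
  sInf (WDG.cost α '' {G : WDG m | IsTransportPath X G a b})

/-- An optimal transport path from `a` to `b`. -/
def IsOptimalTP {m : ℕ} (X : Set (Pt m)) (α : ℝ) (G : WDG m) (a b : Pt m →₀ ℝ) : Prop :=
  IsTransportPath X G a b ∧
    ∀ G' : WDG m, IsTransportPath X G' a b → WDG.cost α G ≤ WDG.cost α G'

/-- The atomic probability measure `b = Σ_j n_j δ_{y_j}` of households. -/
def bMeas {m ℓ : ℕ} (y : Fin ℓ → Pt m) (n : Fin ℓ → ℝ) : Pt m →₀ ℝ :=
  ∑ j, Finsupp.single (y j) (n j)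

/-- An allocation path from the factory locations `x` to the households `(y,n)`:
a transport path to `b` from some atomic probability measure supported on the
factory locations. -/
def IsAllocPath {m k ℓ : ℕ} (X : Set (Pt m)) (x : Fin k → Pt m)
    (y : Fin ℓ → Pt m) (n : Fin ℓ → ℝ) (G : WDG m) : Prop :=
  ∃ a : Pt m →₀ ℝ, (∀ z, 0 ≤ a z) ∧ ↑a.support ⊆ Set.range x ∧ massOf a = 1 ∧
    IsTransportPath X G a (bMeas y n)

/-- An optimal allocation path: it minimizes `M_α` over all allocation paths. -/
def IsOptimalAllocPath {m k ℓ : ℕ} (X : Set (Pt m)) (α : ℝ) (x : Fin k → Pt m)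
    (y : Fin ℓ → Pt m) (n : Fin ℓ → ℝ) (G : WDG m) : Prop :=
  IsAllocPath X x y n G ∧
    ∀ G' : WDG m, IsAllocPath X x y n G' → WDG.cost α G ≤ WDG.cost α G'

/-- For an assignment map `S`, the part `b_i = Σ_{j : S(j) = i} n_j δ_{y_j}`. -/
def bPart {m k ℓ : ℕ} (y : Fin ℓ → Pt m) (n : Fin ℓ → ℝ) (S : Fin ℓ → Fin k)
    (i : Fin k) : Pt m →₀ ℝ :=
  ∑ j ∈ Finset.univ.filter (fun j => S j = i), Finsupp.single (y j) (n j)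

/-- The mass `m(b_i) = Σ_{j : S(j) = i} n_j`. -/
def mB {k ℓ : ℕ} (n : Fin ℓ → ℝ) (S : Fin ℓ → Fin k) (i : Fin k) : ℝ :=
  ∑ j ∈ Finset.univ.filter (fun j => S j = i), n j

/-- `E_α(S) = Σ_i d_α(m(b_i) δ_{x_i}, b_i)`. -/
def Ealpha {m k ℓ : ℕ} (X : Set (Pt m)) (α : ℝ) (x : Fin k → Pt m)
    (y : Fin ℓ → Pt m) (n : Fin ℓ → ℝ) (S : Fin ℓ → Fin k) : ℝ :=
  ∑ i, dCost X α (Finsupp.single (x i) (mB n S i)) (bPart y n S i)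

/-- An optimal assignment map minimizes `E_α` over all assignment maps. -/
def IsOptimalAssign {m k ℓ : ℕ} (X : Set (Pt m)) (α : ℝ) (x : Fin k → Pt m)
    (y : Fin ℓ → Pt m) (n : Fin ℓ → ℝ) (S : Fin ℓ → Fin k) : Prop :=
  ∀ S' : Fin ℓ → Fin k, Ealpha X α x y n S ≤ Ealpha X α x y n S'

/-- `ρ_α(σ,ε)`: equals `(σ/ε)^α − (σ/ε − 1)^α` for `σ > ε` (and for `σ = ε` when
`α ∈ (0,1)`), and equals `1` when `σ = ε` (covering also the convention for `α = 0`). -/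
def rho (α σ ε : ℝ) : ℝ :=
  if σ = ε then 1 else (σ / ε) ^ α - (σ / ε - 1) ^ α


/-- `G` is the disjoint union of the subgraphs `Gi`: the `Gi` have pairwise
disjoint vertex sets, each is a subgraph of `G` (with matching weights), and
the edges of `G` are exactly the (disjoint) union of their edges. -/
def IsDisjointUnion {m k : ℕ} (G : WDG m) (Gi : Fin k → WDG m) : Prop :=
  (∀ i i' : Fin k, i ≠ i' → Disjoint (Gi i).V (Gi i').V) ∧
  (∀ i, (Gi i).V ⊆ G.V) ∧
  (∀ i, (Gi i).E ⊆ G.E) ∧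
  (∀ i, ∀ e ∈ (Gi i).E, (Gi i).w e = G.w e) ∧
  G.E = Finset.univ.biUnion (fun i => (Gi i).E)

/-- The projection coordinate `π(z) = ⟨z − p, v⟩` along the line through `p`
in direction `v`. -/
def proj {m : ℕ} (p v z : Pt m) : ℝ := ⟪z - p, v⟫

/-- The constant `C = √(m−1)/(2^{1−(m−1)(1−α)} − 1) + 1`. -/
def Cconst (m : ℕ) (α : ℝ) : ℝ :=
  Real.sqrt ((m : ℝ) - 1) / ((2 : ℝ) ^ (1 - ((m : ℝ) - 1) * (1 - α)) - 1) + 1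


namespace NetFlow

variable {P : Type*}

/-- The concave cost per unit length of an edge carrying flow `t`: `t ^ α` if `t` is positive,
and `0` otherwise. -/
def posPow (α t : ℝ) : ℝ := if 0 < t then t ^ α else 0

lemma posPow_of_pos {α t : ℝ} (ht : 0 < t) : posPow α t = t ^ α := if_pos ht

lemma posPow_of_nonpos {α t : ℝ} (ht : t ≤ 0) : posPow α t = 0 := if_neg ht.not_gt

lemma posPow_nonneg (α t : ℝ) : 0 ≤ posPow α t := by
  unfold posPow
  split_ifs with h
  · positivity
  · exact le_rfl

lemma posPow_mono {α : ℝ} (hα : 0 ≤ α) {s t : ℝ} (hst : s ≤ t) : posPow α s ≤ posPow α t := by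
  rcases le_or_gt s 0 with hs | hs
  · rw [posPow_of_nonpos hs]
    exact posPow_nonneg _ _
  · rw [posPow_of_pos hs, posPow_of_pos (hs.trans_le hst)]
    exact Real.rpow_le_rpow hs.le hst hα

lemma posPow_add_le {α : ℝ} (hα0 : 0 ≤ α) (hα1 : α ≤ 1) (s t : ℝ) :
    posPow α (s + t) ≤ posPow α s + posPow α t := by
  rcases le_or_gt s 0 with hs | hs
  · have := posPow_mono hα0 (show s + t ≤ t by linarith)
    linarith [posPow_nonneg α s]
  rcases le_or_gt t 0 with ht | ht
  · have := posPow_mono hα0 (show s + t ≤ s by linarith)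
    linarith [posPow_nonneg α t]
  rw [posPow_of_pos hs, posPow_of_pos ht, posPow_of_pos (add_pos hs ht)]
  exact Real.rpow_add_le_add_rpow hs.le ht.le hα0 hα1

/-- The tangent line bound for the concave function `posPow α` at a positive point. -/
lemma posPow_add_le_tangent {α : ℝ} (hα0 : 0 ≤ α) (hα1 : α ≤ 1) {u s : ℝ} (hu : 0 < u)
    (hus : 0 ≤ u + s) : posPow α (u + s) ≤ posPow α u + α * u ^ α / u * s := by
  have hsu : -1 ≤ s / u := by
    rw [le_div_iff₀ hu]
    linarith
  have hpow : 0 < u ^ α := by positivity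
  have hrw : posPow α u + α * u ^ α / u * s = u ^ α * (1 + α * (s / u)) := by
    rw [posPow_of_pos hu]
    field_simp
  rw [hrw]
  rcases hus.eq_or_lt with h0 | h0
  · rw [posPow_of_nonpos h0.symm.le]
    have : 0 ≤ 1 + α * (s / u) := by nlinarith
    positivity
  · rw [posPow_of_pos h0, show u + s = u * (1 + s / u) by field_simp,
      Real.mul_rpow hu.le (by linarith)]
    exact mul_le_mul_of_nonneg_left (rpow_one_add_le_one_add_mul_self hsu hα0 hα1) hpow.le

lemma concaveOn_posPow {α : ℝ} (hα0 : 0 ≤ α) (hα1 : α ≤ 1) :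
    ConcaveOn ℝ (Set.Ici 0) (posPow α) := by
  rcases hα0.eq_or_lt with rfl | hα
  · refine ⟨convex_Ici 0, fun x hx y hy a b ha hb hab => ?_⟩
    simp only [Set.mem_Ici, smul_eq_mul] at *
    by_cases hpos : 0 < a * x + b * y
    · rw [posPow_of_pos hpos, Real.rpow_zero]
      have h1 : ∀ t, posPow 0 t ≤ 1 := fun t => by
        unfold posPow
        split_ifs <;> simp
      nlinarith [h1 x, h1 y]
    · rw [posPow_of_nonpos (not_lt.1 hpos)]
      have hax : 0 ≤ a * x := by positivity
      have hby : 0 ≤ b * y := by positivity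
      have key : ∀ c z : ℝ, 0 ≤ z → c * z = 0 → c * posPow 0 z = 0 := fun c z hz hcz => by
        rcases mul_eq_zero.1 hcz with h | h
        · simp [h]
        · simp [posPow, h]
      rw [key a x hx (by linarith), key b y hy (by linarith), add_zero]
  · refine (Real.concaveOn_rpow hα0 hα1).congr fun t ht => ?_
    rcases (Set.mem_Ici.1 ht).eq_or_lt with h | h
    · simp [posPow, ← h, Real.zero_rpow hα.ne']
    · rw [posPow_of_pos h]

/-- Increments of `posPow α` of fixed size decrease along the nonnegative half-line. -/
lemma posPow_increment_anti {α : ℝ} (hα0 : 0 ≤ α) (hα1 : α ≤ 1) {s t ε : ℝ} (hs : 0 ≤ s)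
    (hst : s ≤ t) (hε : 0 ≤ ε) :
    posPow α (t + ε) - posPow α t ≤ posPow α (s + ε) - posPow α s := by
  rcases hε.eq_or_lt with rfl | hε
  · simp
  have hc := concaveOn_posPow hα0 hα1
  have hd : 0 < t - s + ε := by linarith
  have hs' : s ∈ Set.Ici (0 : ℝ) := hs
  have ht' : t + ε ∈ Set.Ici (0 : ℝ) := Set.mem_Ici.2 (by linarith)
  have hp : 0 ≤ (t - s) / (t - s + ε) := div_nonneg (by linarith) hd.le
  have hq : 0 ≤ ε / (t - s + ε) := by positivity
  have hsum : (t - s) / (t - s + ε) + ε / (t - s + ε) = 1 := by field_simp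
  have e1 := hc.2 hs' ht' hp hq hsum
  have e2 := hc.2 hs' ht' hq hp (by linarith)
  simp only [smul_eq_mul] at e1 e2
  rw [show (t - s) / (t - s + ε) * s + ε / (t - s + ε) * (t + ε) = s + ε by field_simp; ring]
    at e1
  rw [show ε / (t - s + ε) * s + (t - s) / (t - s + ε) * (t + ε) = t by field_simp; ring] at e2
  have : (t - s) / (t - s + ε) = 1 - ε / (t - s + ε) := by linarith
  rw [this] at e1 e2
  linarith

/-- A net flow on the finite vertex set `V` with net supply `a`. -/
structure IsFlow (V : Finset P) (a : P → ℝ) (f : P → P → ℝ) : Prop where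
  antisymm : ∀ u v, f v u = -f u v
  mem_left : ∀ {u v}, f u v ≠ 0 → u ∈ V
  div_eq : ∀ u, ∑ v ∈ V, f u v = a u

namespace IsFlow

variable {V : Finset P} {a b : P → ℝ} {f g : P → P → ℝ}

lemma mem_right (hf : IsFlow V a f) {u v : P} (h : f u v ≠ 0) : v ∈ V :=
  hf.mem_left (u := v) (v := u) (by rw [hf.antisymm u v]; exact neg_ne_zero.2 h)

lemma self_eq_zero (hf : IsFlow V a f) (u : P) : f u u = 0 := by
  linarith [hf.antisymm u u]

lemma add (hf : IsFlow V a f) (hg : IsFlow V b g) :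
    IsFlow V (fun u => a u + b u) (fun u v => f u v + g u v) where
  antisymm u v := by rw [hf.antisymm u v, hg.antisymm u v]; ring
  mem_left {u v} h := by
    by_contra hu
    have h1 : f u v = 0 := by_contra fun h' => hu (hf.mem_left h')
    have h2 : g u v = 0 := by_contra fun h' => hu (hg.mem_left h')
    exact h (by rw [h1, h2, add_zero])
  div_eq u := by rw [Finset.sum_add_distrib, hf.div_eq, hg.div_eq]

lemma smul (hf : IsFlow V a f) (t : ℝ) :
    IsFlow V (fun u => t * a u) (fun u v => t * f u v) where
  antisymm u v := by rw [hf.antisymm u v]; ring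
  mem_left h := hf.mem_left (right_ne_zero_of_mul h)
  div_eq u := by rw [← Finset.mul_sum, hf.div_eq]

lemma zero : IsFlow V (fun _ => 0) (fun _ _ => 0) where
  antisymm _ _ := by simp
  mem_left h := absurd rfl h
  div_eq _ := by simp

/-- The net flow leaving a vertex subset is the net supply inside it. -/
lemma sum_supply_eq (hf : IsFlow V a f) (K : P → Prop) :
    ∑ u ∈ V with K u, a u = ∑ u ∈ V with K u, ∑ v ∈ V with ¬ K v, f u v := by
  have hcancel : ∑ u ∈ V with K u, ∑ v ∈ V with K v, f u v = 0 := by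
    have h1 : ∑ u ∈ V with K u, ∑ v ∈ V with K v, f u v
        = ∑ u ∈ V with K u, ∑ v ∈ V with K v, -f u v := by
      rw [Finset.sum_comm]
      exact Finset.sum_congr rfl fun u _ => Finset.sum_congr rfl fun v _ => hf.antisymm u v
    simp only [Finset.sum_neg_distrib] at h1
    linarith
  calc ∑ u ∈ V with K u, a u
      = ∑ u ∈ V with K u, (∑ v ∈ V with K v, f u v + ∑ v ∈ V with ¬ K v, f u v) :=
        Finset.sum_congr rfl fun u _ => by
          rw [Finset.sum_filter_add_sum_filter_not, hf.div_eq]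
    _ = _ := by rw [Finset.sum_add_distrib, hcancel, zero_add]

end IsFlow

/-- The unit flow along a single arc. -/
def arc (u v : P) : P → P → ℝ := fun p q =>
  (if p = u ∧ q = v then 1 else 0) - (if p = v ∧ q = u then 1 else 0)

lemma isFlow_arc {V : Finset P} {u v : P} (hu : u ∈ V) (hv : v ∈ V) :
    IsFlow V (fun w => (if w = u then 1 else 0) - (if w = v then 1 else 0)) (arc u v) where
  antisymm p q := by simp only [arc, and_comm]; ring
  mem_left {p q} h := by
    by_contra hp
    refine h ?_
    have h1 : p ≠ u := fun e => hp (e ▸ hu)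
    have h2 : p ≠ v := fun e => hp (e ▸ hv)
    simp [arc, h1, h2]
  div_eq p := by
    simp only [arc, Finset.sum_sub_distrib, ite_and]
    split_ifs <;> simp [hu, hv]

/-- The sum of the unit flows along a list of arcs. -/
def arcs (L : List (P × P)) : P → P → ℝ := fun p q => (L.map fun e => arc e.1 e.2 p q).sum

lemma arcs_cons (e : P × P) (L : List (P × P)) (p q : P) :
    arcs (e :: L) p q = arc e.1 e.2 p q + arcs L p q := by
  simp [arcs]

lemma arcs_eq_of_nodup {L : List (P × P)} (hL : L.Nodup) (p q : P) :
    arcs L p q = (if (p, q) ∈ L then 1 else 0) - (if (q, p) ∈ L then 1 else 0) := by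
  induction L with
  | nil => simp [arcs]
  | cons e L ih =>
    obtain ⟨he, hL'⟩ := List.nodup_cons.1 hL
    obtain ⟨u, v⟩ := e
    rw [arcs_cons, ih hL']
    have key : ∀ r s : P, (if (r, s) ∈ (u, v) :: L then (1 : ℝ) else 0)
        = (if r = u ∧ s = v then 1 else 0) + (if (r, s) ∈ L then 1 else 0) := by
      intro r s
      by_cases h : r = u ∧ s = v
      · obtain ⟨rfl, rfl⟩ := h
        simp [he]
      · simp [h]
    rw [key, key]
    simp only [arc, and_comm]
    ring

/-- The arcs traversed by a walk. -/
def walkArcs {G : SimpleGraph P} {x y : P} (p : G.Walk x y) : List (P × P) :=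
  p.darts.map SimpleGraph.Dart.toProd

lemma walkArcs_cons {G : SimpleGraph P} {x z y : P} (h : G.Adj x z) (p : G.Walk z y) :
    walkArcs (SimpleGraph.Walk.cons h p) = (x, z) :: walkArcs p := rfl

lemma isFlow_walk {V : Finset P} {G : SimpleGraph P} (hG : ∀ u v, G.Adj u v → u ∈ V) {x y : P}
    (p : G.Walk x y) :
    IsFlow V (fun w => (if w = x then 1 else 0) - (if w = y then 1 else 0))
      (arcs (walkArcs p)) := by
  induction p with
  | nil =>
    simp only [sub_self]
    exact IsFlow.zero
  | cons h p ih =>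
    have := (isFlow_arc (hG _ _ h) (hG _ _ h.symm)).add ih
    simp only [sub_add_sub_cancel] at this
    exact this

lemma arcs_walk_eq_zero {G : SimpleGraph P} {x y : P} (p : G.Walk x y) {u v : P}
    (huv : ¬ G.Adj u v) : arcs (walkArcs p) u v = 0 := by
  induction p with
  | nil => simp [walkArcs, arcs]
  | @cons r s _ h p ih =>
    rw [walkArcs_cons, arcs_cons, ih, add_zero]
    have h1 : ¬ (u = r ∧ v = s) := by
      rintro ⟨rfl, rfl⟩
      exact huv h
    have h2 : ¬ (u = s ∧ v = r) := by
      rintro ⟨rfl, rfl⟩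
      exact huv h.symm
    simp only [arc, if_neg h1, if_neg h2, sub_zero]

lemma dist_le_sum_walkArcs [PseudoMetricSpace P] {G : SimpleGraph P} {x y : P} (p : G.Walk x y) :
    dist x y ≤ ((walkArcs p).map fun e => dist e.1 e.2).sum := by
  induction p with
  | nil => simp [walkArcs]
  | cons h p ih =>
    simp only [walkArcs_cons, List.map_cons, List.sum_cons]
    exact (dist_triangle _ _ _).trans (by linarith)

lemma nodup_walkArcs {G : SimpleGraph P} {x y : P} {p : G.Walk x y} (hp : p.IsPath) :
    (walkArcs p).Nodup := by
  have : (p.darts.map SimpleGraph.Dart.edge).Nodup := hp.isTrail.edges_nodup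
  exact (List.Nodup.of_map _ this).map SimpleGraph.Dart.toProd_injective

lemma mem_support_of_mem_walkArcs {G : SimpleGraph P} {x y : P} {p : G.Walk x y} {u v : P}
    (h : (u, v) ∈ walkArcs p) : u ∈ p.support ∧ v ∈ p.support ∧ G.Adj u v := by
  obtain ⟨d, hd, hduv⟩ := List.mem_map.1 h
  obtain ⟨⟨a, b⟩, hadj⟩ := d
  obtain ⟨rfl, rfl⟩ := Prod.mk.inj hduv
  exact ⟨p.dart_fst_mem_support_of_mem_darts hd, p.dart_snd_mem_support_of_mem_darts hd, hadj⟩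

/-- Deleting an arc of a path leaves its two remaining parts intact. -/
lemma reachable_deleteEdges_of_mem_path {G : SimpleGraph P} {x y : P} {p : G.Walk x y}
    (hp : p.IsPath) {u v : P} (h : (u, v) ∈ walkArcs p) :
    (G.deleteEdges {s(u, v)}).Reachable x u ∧ (G.deleteEdges {s(u, v)}).Reachable v y := by
  induction p with
  | nil => simp [walkArcs] at h
  | @cons x z y hxz p ih =>
    obtain ⟨hp', hx⟩ := (SimpleGraph.Walk.cons_isPath_iff _ _).1 hp
    rw [walkArcs_cons, List.mem_cons] at h
    rcases h with h | h
    · obtain ⟨rfl, rfl⟩ := Prod.mk.inj h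
      refine ⟨SimpleGraph.Reachable.refl _, ⟨p.toDeleteEdges {s(u, v)} fun e he hmem => ?_⟩⟩
      rw [Set.mem_singleton_iff.1 hmem] at he
      exact hx (p.fst_mem_support_of_mem_edges he)
    · obtain ⟨h1, h2⟩ := ih hp' h
      obtain ⟨hu, hv, -⟩ := mem_support_of_mem_walkArcs h
      refine ⟨SimpleGraph.Reachable.trans (SimpleGraph.Adj.reachable ?_) h1, h2⟩
      rw [SimpleGraph.deleteEdges_adj]
      refine ⟨hxz, fun hmem => ?_⟩
      rcases Sym2.eq_iff.1 (Set.mem_singleton_iff.1 hmem) with ⟨rfl, -⟩ | ⟨rfl, -⟩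
      · exact hx hu
      · exact hx hv

/-- The undirected graph formed by the arcs carrying flow. -/
def flowGraph (f : P → P → ℝ) : SimpleGraph P := SimpleGraph.fromRel fun u v => 0 < f u v

lemma IsFlow.flowGraph_adj {V : Finset P} {a : P → ℝ} {f : P → P → ℝ} (hf : IsFlow V a f)
    {u v : P} : (flowGraph f).Adj u v ↔ f u v ≠ 0 := by
  rw [flowGraph, SimpleGraph.fromRel_adj, hf.antisymm u v]
  constructor
  · rintro ⟨-, h | h⟩ h0 <;> linarith
  · intro h
    refine ⟨fun e => h (e ▸ hf.self_eq_zero u), ?_⟩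
    rcases lt_or_gt_of_ne h with h | h
    · right; linarith
    · left; exact h

/-- In a forest, the flow from a single source `x` of mass `M` to nonnegative demands `b`
carries at least `b y` along the path from `x` to `y`, and at most `M`. -/
lemma IsFlow.exists_path [PseudoMetricSpace P] {V : Finset P} {a : P → ℝ} {f : P → P → ℝ}
    (hf : IsFlow V a f) (hforest : (flowGraph f).IsAcyclic) {x y : P} {M : ℝ} {b : P → ℝ}
    (ha : ∀ u, a u = (if u = x then M else 0) - b u) (hb : ∀ u, 0 ≤ b u)
    (hM : ∑ u ∈ V, b u = M) (hyV : y ∈ V) (hy : 0 < b y) :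
    ∃ L : List (P × P), L.Nodup ∧
      IsFlow V (fun w => (if w = x then 1 else 0) - (if w = y then 1 else 0)) (arcs L) ∧
      dist x y ≤ (L.map fun e => dist e.1 e.2).sum ∧
      ∀ e ∈ L, b y ≤ f e.1 e.2 ∧ f e.1 e.2 ≤ M := by
  have hdemand : ∀ K : P → Prop, ¬ K x →
      ∑ u ∈ V with K u, b u = ∑ u ∈ V with K u, ∑ v ∈ V with ¬ K v, f v u := by
    intro K hx
    have h1 := hf.sum_supply_eq K
    have h2 : ∑ u ∈ V with K u, a u = -∑ u ∈ V with K u, b u := by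
      rw [← Finset.sum_neg_distrib]
      refine Finset.sum_congr rfl fun u hu => ?_
      have hux : u ≠ x := fun e => hx (e ▸ (Finset.mem_filter.1 hu).2)
      rw [ha, if_neg hux, zero_sub]
    have h3 : ∑ u ∈ V with K u, ∑ v ∈ V with ¬ K v, f v u
        = -∑ u ∈ V with K u, ∑ v ∈ V with ¬ K v, f u v := by
      simp only [← Finset.sum_neg_distrib]
      exact Finset.sum_congr rfl fun u _ => Finset.sum_congr rfl fun v _ => hf.antisymm u v
    linarith
  have hle : ∀ K : P → Prop, K y → b y ≤ ∑ u ∈ V with K u, b u := fun K hK =>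
    Finset.single_le_sum (f := b) (fun u _ => hb u) (Finset.mem_filter.2 ⟨hyV, hK⟩)
  have hreach : (flowGraph f).Reachable x y := by
    by_contra hxy
    have h1 := hdemand (fun u => (flowGraph f).Reachable u y) hxy
    have h2 := hle (fun u => (flowGraph f).Reachable u y) (SimpleGraph.Reachable.refl _)
    rw [h1, Finset.sum_eq_zero] at h2
    · linarith
    intro u hu
    refine Finset.sum_eq_zero fun v hv => by_contra fun hne => ?_
    exact (Finset.mem_filter.1 hv).2
      ((hf.flowGraph_adj.2 hne).reachable.trans (Finset.mem_filter.1 hu).2)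
  obtain ⟨p, hp⟩ := hreach.exists_isPath
  refine ⟨walkArcs p, nodup_walkArcs hp,
    isFlow_walk (fun u v huv => hf.mem_left (hf.flowGraph_adj.1 huv)) p,
    dist_le_sum_walkArcs p, ?_⟩
  rintro ⟨u, v⟩ huv
  obtain ⟨hxu, hvy⟩ := reachable_deleteEdges_of_mem_path hp huv
  have hadj := (mem_support_of_mem_walkArcs huv).2.2
  have hne := hf.flowGraph_adj.1 hadj
  have hbridge := SimpleGraph.isBridge_iff.1
    (SimpleGraph.isAcyclic_iff_forall_adj_isBridge.1 hforest hadj)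
  set H := (flowGraph f).deleteEdges {s(u, v)} with hH
  have hu : ¬ H.Reachable u y := fun h => hbridge (h.trans hvy.symm)
  have hx : ¬ H.Reachable x y := fun h => hu (hxu.symm.trans h)
  have hval : ∑ r ∈ V with H.Reachable r y, b r = f u v := by
    rw [hdemand _ hx, Finset.sum_eq_single v, Finset.sum_eq_single u]
    · intro w hw hwu
      by_contra hwv
      refine (Finset.mem_filter.1 hw).2 (SimpleGraph.Reachable.trans ?_ hvy)
      refine SimpleGraph.Adj.reachable ?_
      rw [hH, SimpleGraph.deleteEdges_adj]
      refine ⟨hf.flowGraph_adj.2 hwv, fun hmem => ?_⟩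
      rcases Sym2.eq_iff.1 (Set.mem_singleton_iff.1 hmem) with ⟨h, -⟩ | ⟨h, h'⟩
      · exact hwu h
      · exact hadj.ne h'.symm
    · exact fun h => absurd (Finset.mem_filter.2 ⟨hf.mem_left hne, hu⟩) h
    · intro r hr hrv
      refine Finset.sum_eq_zero fun w hw => by_contra fun hwr => ?_
      refine (Finset.mem_filter.1 hw).2
        (SimpleGraph.Reachable.trans ?_ (Finset.mem_filter.1 hr).2)
      refine SimpleGraph.Adj.reachable ?_
      rw [hH, SimpleGraph.deleteEdges_adj]
      refine ⟨hf.flowGraph_adj.2 hwr, fun hmem => ?_⟩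
      rcases Sym2.eq_iff.1 (Set.mem_singleton_iff.1 hmem) with ⟨-, h⟩ | ⟨-, h⟩
      · exact hrv h
      · exact hu (h ▸ (Finset.mem_filter.1 hr).2)
    · exact fun h => absurd (Finset.mem_filter.2 ⟨hf.mem_right hne, hvy⟩) h
  constructor
  · exact hval ▸ hle _ (SimpleGraph.Reachable.refl y)
  · rw [← hM, ← hval]
    exact Finset.sum_le_sum_of_subset_of_nonneg (Finset.filter_subset _ _) fun u _ _ => hb u

section Cost

variable [PseudoMetricSpace P] {α : ℝ} {V : Finset P} {a : P → ℝ} {f g : P → P → ℝ}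

/-- The cost of a net flow, each arc being counted in the direction in which mass moves. -/
def flowCost (α : ℝ) (V : Finset P) (f : P → P → ℝ) : ℝ :=
  ∑ e ∈ V ×ˢ V, posPow α (f e.1 e.2) * dist e.1 e.2

lemma flowCost_add_le (hα0 : 0 ≤ α) (hα1 : α ≤ 1) :
    flowCost α V (fun u v => f u v + g u v) ≤ flowCost α V f + flowCost α V g := by
  unfold flowCost
  rw [← Finset.sum_add_distrib]
  refine Finset.sum_le_sum fun e _ => ?_
  rw [← add_mul]
  exact mul_le_mul_of_nonneg_right (posPow_add_le hα0 hα1 _ _) dist_nonneg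

lemma flowCost_smul_arc_le (hα0 : 0 ≤ α) {t : ℝ} (ht : 0 < t) (u v : P) :
    flowCost α V (fun p q => t * arc u v p q) ≤ t ^ α * dist u v := by
  have hpt : ∀ e ∈ V ×ˢ V, posPow α (t * arc u v e.1 e.2) * dist e.1 e.2
      ≤ if (u, v) = e then t ^ α * dist u v else 0 := by
    rintro ⟨p, q⟩ -
    by_cases he : (u, v) = (p, q)
    · obtain ⟨rfl, rfl⟩ := Prod.mk.inj he
      rw [if_pos rfl, ← posPow_of_pos ht]
      refine mul_le_mul_of_nonneg_right (posPow_mono hα0 ?_) dist_nonneg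
      have : arc u v u v ≤ 1 := by
        unfold arc
        split_ifs <;> norm_num
      nlinarith
    · rw [if_neg he, posPow_of_nonpos, zero_mul]
      have h1 : ¬ (p = u ∧ q = v) := fun ⟨e1, e2⟩ => he (by rw [e1, e2])
      have : arc u v p q ≤ 0 := by
        simp only [arc, if_neg h1]
        split_ifs <;> norm_num
      exact mul_nonpos_of_nonneg_of_nonpos ht.le this
  refine (Finset.sum_le_sum hpt).trans ?_
  rw [Finset.sum_ite_eq]
  split_ifs
  · exact le_rfl
  · positivity

/-- Sending the amount `t` (of either sign) along arcs which carry at least `|t|`. -/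
lemma IsFlow.flowCost_add_arcs_le (hf : IsFlow V a f) {L : List (P × P)} (hL : L.Nodup) {t κ : ℝ}
    (h : ∀ e ∈ L, 0 < f e.1 e.2 ∧ |t| ≤ f e.1 e.2 ∧
      posPow α (f e.1 e.2 + t) ≤ posPow α (f e.1 e.2) + κ) :
    flowCost α V (fun u v => f u v + t * arcs L u v)
      ≤ flowCost α V f + κ * (L.map fun e => dist e.1 e.2).sum := by
  have hsum : κ * (L.map fun e => dist e.1 e.2).sum
      = ∑ e ∈ V ×ˢ V, if e ∈ L then κ * dist e.1 e.2 else 0 := by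
    rw [← List.sum_toFinset _ hL, Finset.mul_sum, ← Finset.sum_filter]
    refine Finset.sum_congr ?_ fun _ _ => rfl
    ext e
    simp only [List.mem_toFinset, Finset.mem_filter, Finset.mem_product]
    refine ⟨fun he => ⟨⟨?_, ?_⟩, he⟩, fun he => he.2⟩
    · exact hf.mem_left (h e he).1.ne'
    · exact hf.mem_right (h e he).1.ne'
  rw [hsum]
  unfold flowCost
  rw [← Finset.sum_add_distrib]
  refine Finset.sum_le_sum ?_
  rintro ⟨u, v⟩ -
  simp only [arcs_eq_of_nodup hL]
  by_cases h1 : (u, v) ∈ L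
  · obtain ⟨hpos, -, hκ⟩ := h _ h1
    have h2 : (v, u) ∉ L := fun h2 => by
      have := (h _ h2).1
      simp only [hf.antisymm u v] at this hpos
      linarith
    rw [if_pos h1, if_neg h2, if_pos h1, sub_zero, mul_one, ← add_mul]
    exact mul_le_mul_of_nonneg_right hκ dist_nonneg
  by_cases h2 : (v, u) ∈ L
  · obtain ⟨hpos, ht, -⟩ := h _ h2
    simp only [hf.antisymm u v] at hpos ht
    rw [if_neg h1, if_pos h2, if_neg h1, posPow_of_nonpos, posPow_of_nonpos]
    · simp
    · linarith
    · linarith [neg_abs_le t]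
  · rw [if_neg h1, if_neg h2, if_neg h1]
    simp

/-- A circulation on the support of a flow allows the support to be shrunk without increasing the
cost. -/
lemma IsFlow.exists_smaller_support (hα0 : 0 ≤ α) (hα1 : α ≤ 1) (hf : IsFlow V a f)
    {c : P → P → ℝ} (hc : IsFlow V (fun _ => 0) c) (hcf : ∀ u v, f u v = 0 → c u v = 0)
    {u₀ v₀ : P} (hc0 : c u₀ v₀ ≠ 0) :
    ∃ g, IsFlow V a g ∧ flowCost α V g ≤ flowCost α V f ∧
      ((V ×ˢ V).filter fun e => g e.1 e.2 ≠ 0).card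
        < ((V ×ˢ V).filter fun e => f e.1 e.2 ≠ 0).card := by
  set T := (V ×ˢ V).filter fun e => 0 < f e.1 e.2
  set slope : P × P → ℝ := fun e => α * f e.1 e.2 ^ α / f e.1 e.2 * dist e.1 e.2 with hslope
  have hT_mem : ∀ {u v}, 0 < f u v → (u, v) ∈ T := fun {u v} h =>
    Finset.mem_filter.2
      ⟨Finset.mem_product.2 ⟨hf.mem_left h.ne', hf.mem_right h.ne'⟩, h⟩
  -- orient the circulation so that it does not increase the cost and drains some arc
  obtain ⟨c, hc, hcf, hD, hneg⟩ : ∃ c : P → P → ℝ, IsFlow V (fun _ => 0) c ∧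
      (∀ u v, f u v = 0 → c u v = 0) ∧ ∑ e ∈ T, slope e * c e.1 e.2 ≤ 0 ∧
      ∃ e ∈ T, c e.1 e.2 < 0 := by
    have hslope_nonneg : ∀ e ∈ T, 0 ≤ slope e := fun e he => by
      have : 0 < f e.1 e.2 := (Finset.mem_filter.1 he).2
      simp only [hslope]
      positivity
    have hstrict : ∀ c : P → P → ℝ, ∑ e ∈ T, slope e * c e.1 e.2 < 0 → ∃ e ∈ T, c e.1 e.2 < 0 := by
      intro c hlt
      by_contra! hall
      exact hlt.not_ge (Finset.sum_nonneg fun e he => mul_nonneg (hslope_nonneg e he) (hall e he))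
    have hc' : IsFlow V (fun _ => 0) (fun u v => -1 * c u v) := by simpa using hc.smul (-1)
    have hcf' : ∀ u v, f u v = 0 → -1 * c u v = 0 := fun u v h => by rw [hcf u v h, mul_zero]
    have hsum' : ∑ e ∈ T, slope e * (-1 * c e.1 e.2) = -∑ e ∈ T, slope e * c e.1 e.2 := by
      rw [← Finset.sum_neg_distrib]
      exact Finset.sum_congr rfl fun _ _ => by ring
    rcases lt_trichotomy (∑ e ∈ T, slope e * c e.1 e.2) 0 with hlt | heq | hgt
    · exact ⟨c, hc, hcf, hlt.le, hstrict c hlt⟩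
    · obtain ⟨e, he, hce⟩ : ∃ e ∈ T, c e.1 e.2 ≠ 0 := by
        rcases lt_or_gt_of_ne (fun h => hc0 (hcf _ _ h) : f u₀ v₀ ≠ 0) with h | h
        · refine ⟨(v₀, u₀), hT_mem ?_, ?_⟩
          · rw [hf.antisymm u₀ v₀]; linarith
          · simpa only [hc.antisymm u₀ v₀, neg_ne_zero] using hc0
        · exact ⟨(u₀, v₀), hT_mem h, hc0⟩
      rcases lt_or_gt_of_ne hce with h | h
      · exact ⟨c, hc, hcf, heq.le, e, he, h⟩
      · exact ⟨_, hc', hcf', by rw [hsum', heq, neg_zero], e, he, by linarith⟩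
    · have hlt : ∑ e ∈ T, slope e * (-1 * c e.1 e.2) < 0 := by rw [hsum']; linarith
      exact ⟨_, hc', hcf', hlt.le, hstrict (fun u v => -1 * c u v) hlt⟩
  obtain ⟨e₁, he₁, hce₁⟩ := hneg
  obtain ⟨e₀, he₀, hmin⟩ := Finset.exists_min_image (T.filter fun e => c e.1 e.2 < 0)
    (fun e => f e.1 e.2 / -c e.1 e.2) ⟨e₁, Finset.mem_filter.2 ⟨he₁, hce₁⟩⟩
  obtain ⟨he₀T, hce₀⟩ := Finset.mem_filter.1 he₀
  have hfe₀ : 0 < f e₀.1 e₀.2 := (Finset.mem_filter.1 he₀T).2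
  set t := f e₀.1 e₀.2 / -c e₀.1 e₀.2
  have htpos : 0 < t := div_pos hfe₀ (by linarith)
  have hnonneg : ∀ {u v}, 0 < f u v → 0 ≤ f u v + t * c u v := by
    intro u v huv
    rcases le_or_gt 0 (c u v) with h | h
    · positivity
    · have := hmin (u, v) (Finset.mem_filter.2 ⟨hT_mem huv, h⟩)
      rw [le_div_iff₀ (by linarith)] at this
      linarith
  have hnonpos : ∀ {u v}, ¬ 0 < f u v → f u v + t * c u v ≤ 0 := by
    intro u v huv
    rcases (not_lt.1 huv).eq_or_lt with h | h
    · rw [h, hcf u v h]; simp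
    · have := hnonneg (u := v) (v := u) (by rw [hf.antisymm u v]; linarith)
      rw [hf.antisymm u v, hc.antisymm u v] at this
      linarith
  refine ⟨fun u v => f u v + t * c u v, ?_, ?_, ?_⟩
  · simpa using hf.add (hc.smul t)
  · have hpt : ∀ e ∈ V ×ˢ V, posPow α (f e.1 e.2 + t * c e.1 e.2) * dist e.1 e.2
        ≤ posPow α (f e.1 e.2) * dist e.1 e.2
          + if 0 < f e.1 e.2 then t * (slope e * c e.1 e.2) else 0 := by
      intro e _
      split_ifs with h
      · have := mul_le_mul_of_nonneg_right (posPow_add_le_tangent hα0 hα1 h (hnonneg h))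
          (dist_nonneg (x := e.1) (y := e.2))
        refine this.trans_eq ?_
        simp only [hslope]
        ring
      · rw [posPow_of_nonpos (hnonpos h), posPow_of_nonpos (not_lt.1 h)]
        simp
    refine (Finset.sum_le_sum hpt).trans ?_
    rw [Finset.sum_add_distrib, ← Finset.sum_filter, ← Finset.mul_sum]
    have := mul_nonpos_of_nonneg_of_nonpos htpos.le hD
    unfold flowCost
    linarith
  · refine Finset.card_lt_card (Finset.ssubset_iff_subset_ne.2 ⟨fun e he => ?_, fun heq => ?_⟩)
    · obtain ⟨heV, hne⟩ := Finset.mem_filter.1 he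
      refine Finset.mem_filter.2 ⟨heV, fun h => hne ?_⟩
      simp only [h, hcf _ _ h, mul_zero, add_zero]
    · have h1 : e₀ ∈ (V ×ˢ V).filter fun e => f e.1 e.2 ≠ 0 :=
        Finset.mem_filter.2 ⟨(Finset.mem_filter.1 he₀T).1, hfe₀.ne'⟩
      rw [← heq] at h1
      refine (Finset.mem_filter.1 h1).2 ?_
      have : t * -c e₀.1 e₀.2 = f e₀.1 e₀.2 := div_mul_cancel₀ _ (by linarith)
      linarith

/-- Every flow can be replaced by one supported on a forest without increasing the cost. -/
lemma IsFlow.exists_forest (hα0 : 0 ≤ α) (hα1 : α ≤ 1) (hf : IsFlow V a f) :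
    ∃ g, IsFlow V a g ∧ (flowGraph g).IsAcyclic ∧ flowCost α V g ≤ flowCost α V f := by
  induction hN : ((V ×ˢ V).filter fun e => f e.1 e.2 ≠ 0).card using Nat.strong_induction_on
    generalizing f with
  | _ N ih =>
    by_cases hac : (flowGraph f).IsAcyclic
    · exact ⟨f, hf, hac, le_rfl⟩
    rw [SimpleGraph.isAcyclic_iff_forall_adj_isBridge] at hac
    push Not at hac
    obtain ⟨u, v, huv, hbridge⟩ := hac
    rw [SimpleGraph.isBridge_iff, not_not] at hbridge
    obtain ⟨p⟩ := hbridge.symm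
    have hmem : ∀ r s, ((flowGraph f).deleteEdges {s(u, v)}).Adj r s → r ∈ V := fun r s h =>
      hf.mem_left (hf.flowGraph_adj.1 ((SimpleGraph.deleteEdges_adj.1 h).1))
    have hfuv := hf.flowGraph_adj.1 huv
    have hc := (isFlow_arc (hf.mem_left hfuv) (hf.mem_right hfuv)).add (isFlow_walk hmem p)
    simp only [sub_add_sub_cancel, sub_self] at hc
    obtain ⟨g, hg, hgf, hcard⟩ := hf.exists_smaller_support hα0 hα1 hc (u₀ := u) (v₀ := v)
      (fun r s hrs => by
        rw [arcs_walk_eq_zero p, add_zero]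
        · have h1 : ¬ (r = u ∧ s = v) := by
            rintro ⟨rfl, rfl⟩
            exact hfuv hrs
          have h2 : ¬ (r = v ∧ s = u) := by
            rintro ⟨rfl, rfl⟩
            exact hfuv (by rw [hf.antisymm r s, hrs, neg_zero])
          simp only [arc, if_neg h1, if_neg h2, sub_zero]
        · exact fun h => hf.flowGraph_adj.1 (SimpleGraph.deleteEdges_adj.1 h).1 hrs)
      (by
        rw [arcs_walk_eq_zero p (by simp [SimpleGraph.deleteEdges_adj])]
        simp [arc, huv.ne])
    obtain ⟨g', hg', hac', hle⟩ := ih _ (hN ▸ hcard) hg rfl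
    exact ⟨g', hg', hac', hle.trans hgf⟩

end Cost

end NetFlow

section TransportPath

open NetFlow

variable {m : ℕ} {X : Set (Pt m)} {α : ℝ} {a b : Pt m →₀ ℝ}

lemma WDG.cost_nonneg {G : WDG m} (hG : G.edgesOK) : 0 ≤ G.cost α :=
  Finset.sum_nonneg fun e he =>
    mul_nonneg (Real.rpow_nonneg (hG e he).2.2.2.le _) dist_nonneg

lemma sum_filter_fst_eq {W : Finset (Pt m)} (u : Pt m) {F : Pt m × Pt m → ℝ}
    (hF : ∀ v, u ∉ W → F (u, v) = 0) :
    ∑ e ∈ W ×ˢ W with e.1 = u, F e = ∑ v ∈ W, F (u, v) := by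
  rw [Finset.sum_filter, Finset.sum_product, Finset.sum_eq_single u]
  · simp
  · intro w _ hw
    simp [hw]
  · intro hu
    simp [hF _ hu]

lemma sum_filter_snd_eq {W : Finset (Pt m)} (u : Pt m) {F : Pt m × Pt m → ℝ}
    (hF : ∀ v, u ∉ W → F (v, u) = 0) :
    ∑ e ∈ W ×ˢ W with e.2 = u, F e = ∑ v ∈ W, F (v, u) := by
  rw [Finset.sum_filter, Finset.sum_product_right, Finset.sum_eq_single u]
  · simp
  · intro w _ hw
    simp [hw]
  · intro hu
    simp [hF _ hu]

/-- The net flow of a transport path costs at most as much as the path. -/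
lemma IsTransportPath.exists_isFlow (hα0 : 0 ≤ α) {G : WDG m} (hG : IsTransportPath X G a b)
    {W : Finset (Pt m)} (hW : G.V ⊆ W) :
    ∃ f, IsFlow W (fun u => a u - b u) f ∧ flowCost α W f ≤ G.cost α := by
  obtain ⟨hE, -, -, -, -, hbal⟩ := hG
  set ω : Pt m → Pt m → ℝ := fun u v => if (u, v) ∈ G.E then G.w (u, v) else 0 with hω
  have hEW : G.E ⊆ W ×ˢ W := fun e he =>
    Finset.mem_product.2 ⟨hW (hE e he).1, hW (hE e he).2.1⟩
  have hω_zero : ∀ {u v}, (u, v) ∉ G.E → ω u v = 0 := fun h => if_neg h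
  have hω_nonneg : ∀ u v, 0 ≤ ω u v := fun u v => by
    by_cases h : (u, v) ∈ G.E
    · simp only [hω, if_pos h]
      exact (hE _ h).2.2.2.le
    · rw [hω_zero h]
  have hmem : ∀ {u v}, ω u v ≠ 0 → (u, v) ∈ G.E := fun h => by_contra fun h' => h (hω_zero h')
  have hout : ∀ u, ∑ v ∈ W, ω u v = G.outflow u := fun u => by
    have h1 : G.outflow u = ∑ e ∈ (W ×ˢ W).filter (fun e => e.1 = u), ω e.1 e.2 := by
      unfold WDG.outflow
      refine (Finset.sum_congr rfl fun e he => ?_).trans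
        (Finset.sum_subset (Finset.filter_subset_filter _ hEW) fun e he he' => ?_)
      · simp only [hω, if_pos (Finset.mem_filter.1 he).1]
      · refine hω_zero fun h => he' (Finset.mem_filter.2 ⟨h, (Finset.mem_filter.1 he).2⟩)
    rw [h1, sum_filter_fst_eq u (F := fun e => ω e.1 e.2)
      fun v hu => hω_zero fun h => hu (hW (hE _ h).1)]
  have hin : ∀ u, ∑ v ∈ W, ω v u = G.inflow u := fun u => by
    have h1 : G.inflow u = ∑ e ∈ (W ×ˢ W).filter (fun e => e.2 = u), ω e.1 e.2 := by
      unfold WDG.inflow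
      refine (Finset.sum_congr rfl fun e he => ?_).trans
        (Finset.sum_subset (Finset.filter_subset_filter _ hEW) fun e he he' => ?_)
      · simp only [hω, if_pos (Finset.mem_filter.1 he).1]
      · refine hω_zero fun h => he' (Finset.mem_filter.2 ⟨h, (Finset.mem_filter.1 he).2⟩)
    rw [h1, sum_filter_snd_eq u (F := fun e => ω e.1 e.2)
      fun v hu => hω_zero fun h => hu (hW (hE _ h).2.1)]
  refine ⟨fun u v => ω u v - ω v u, ⟨fun u v => by ring, fun {u v} h => ?_, fun u => ?_⟩, ?_⟩
  · by_cases h1 : ω u v = 0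
    · have h2 : ω v u ≠ 0 := fun h2 => h (by simp [h1, h2])
      exact hW (hE _ (hmem h2)).2.1
    · exact hW (hE _ (hmem h1)).1
  · rw [Finset.sum_sub_distrib, hout, hin, hbal]
  · have hcost : G.cost α
        = ∑ e ∈ W ×ˢ W, if e ∈ G.E then G.w e ^ α * dist e.1 e.2 else 0 := by
      rw [← Finset.sum_filter, Finset.filter_mem_eq_inter, Finset.inter_eq_right.2 hEW]
      rfl
    rw [hcost]
    refine Finset.sum_le_sum fun e _ => ?_
    have hle : posPow α (ω e.1 e.2 - ω e.2 e.1) ≤ posPow α (ω e.1 e.2) :=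
      posPow_mono hα0 (by linarith [hω_nonneg e.2 e.1])
    refine (mul_le_mul_of_nonneg_right hle dist_nonneg).trans ?_
    by_cases he : e ∈ G.E
    · simp only [hω, if_pos he]
      rw [posPow_of_pos (hE _ he).2.2.2]
    · simp only [hω, if_neg he]
      rw [posPow_of_nonpos le_rfl, zero_mul]

/-- A flow supported on a forest is a transport path of the same cost. -/
lemma NetFlow.IsFlow.exists_transportPath {V : Finset (Pt m)} {f : Pt m → Pt m → ℝ}
    (hf : IsFlow V (fun u => a u - b u) f) (hforest : (flowGraph f).IsAcyclic) (hVX : ↑V ⊆ X)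
    (ha : a.support ⊆ V) (hb : b.support ⊆ V) :
    ∃ G, IsTransportPath X G a b ∧ G.cost α = flowCost α V f := by
  set E := (V ×ˢ V).filter fun e : Pt m × Pt m => 0 < f e.1 e.2 with hE
  have hmemE : ∀ u v, (u, v) ∈ E ↔ 0 < f u v := fun u v => by
    rw [hE, Finset.mem_filter]
    exact ⟨fun h => h.2, fun h =>
      ⟨Finset.mem_product.2 ⟨hf.mem_left h.ne', hf.mem_right h.ne'⟩, h⟩⟩
  refine ⟨⟨V, E, fun e => f e.1 e.2⟩, ⟨?_, hVX, fun z hz => ha hz, fun z hz => hb hz, ?_, ?_⟩, ?_⟩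
  · rintro ⟨u, v⟩ he
    have hpos := (hmemE u v).1 he
    refine ⟨hf.mem_left hpos.ne', hf.mem_right hpos.ne', ?_, hpos⟩
    rintro (rfl : u = v)
    exact hpos.ne' (hf.self_eq_zero u)
  · simp only [WDG.undirected, hmemE]
    exact hforest
  · intro v
    rw [← hf.div_eq v]
    have hout : ∑ e ∈ E.filter (fun e => e.1 = v), f e.1 e.2
        = ∑ u ∈ V, if 0 < f v u then f v u else 0 := by
      rw [hE, Finset.filter_comm, Finset.sum_filter]
      exact sum_filter_fst_eq v (F := fun e => if 0 < f e.1 e.2 then f e.1 e.2 else 0)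
        fun u hv => if_neg fun h => hv (hf.mem_left h.ne')
    have hin : ∑ e ∈ E.filter (fun e => e.2 = v), f e.1 e.2
        = ∑ u ∈ V, if 0 < f u v then f u v else 0 := by
      rw [hE, Finset.filter_comm, Finset.sum_filter]
      exact sum_filter_snd_eq v (F := fun e => if 0 < f e.1 e.2 then f e.1 e.2 else 0)
        fun u hv => if_neg fun h => hv (hf.mem_right h.ne')
    simp only [WDG.outflow, WDG.inflow]
    rw [hout, hin, ← Finset.sum_sub_distrib]
    refine Finset.sum_congr rfl fun u _ => ?_
    rw [hf.antisymm v u]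
    split_ifs <;> linarith
  · simp only [WDG.cost, flowCost, hE, Finset.sum_filter]
    refine Finset.sum_congr rfl fun e _ => ?_
    unfold posPow
    split_ifs <;> simp

/-- Every flow bounds the transport cost from above. -/
lemma dCost_le_flowCost (hα0 : 0 ≤ α) (hα1 : α ≤ 1) {V : Finset (Pt m)} (hVX : ↑V ⊆ X)
    (ha : a.support ⊆ V) (hb : b.support ⊆ V) {f : Pt m → Pt m → ℝ}
    (hf : IsFlow V (fun u => a u - b u) f) : dCost X α a b ≤ flowCost α V f := by
  obtain ⟨g, hg, hforest, hle⟩ := hf.exists_forest hα0 hα1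
  obtain ⟨G, hG, hcost⟩ := hg.exists_transportPath (α := α) hforest hVX ha hb
  rw [← hcost] at hle
  refine le_trans (csInf_le ⟨0, ?_⟩ ⟨G, hG, rfl⟩) hle
  rintro _ ⟨G', hG', rfl⟩
  exact WDG.cost_nonneg hG'.1

/-- A lower bound for the cost of all forest flows is a lower bound for the transport cost. -/
lemma le_dCost (hα0 : 0 ≤ α) (hα1 : α ≤ 1) {V : Finset (Pt m)} (hVX : ↑V ⊆ X)
    (ha : a.support ⊆ V) (hb : b.support ⊆ V) {f₀ : Pt m → Pt m → ℝ}
    (hf₀ : IsFlow V (fun u => a u - b u) f₀) {C : ℝ}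
    (hC : ∀ (W : Finset (Pt m)) (f : Pt m → Pt m → ℝ), V ⊆ W → ↑W ⊆ X →
      IsFlow W (fun u => a u - b u) f → (flowGraph f).IsAcyclic → C ≤ flowCost α W f) :
    C ≤ dCost X α a b := by
  obtain ⟨g, hg, hforest, -⟩ := hf₀.exists_forest hα0 hα1
  obtain ⟨G₀, hG₀, -⟩ := hg.exists_transportPath (α := α) hforest hVX ha hb
  refine le_csInf ⟨_, G₀, hG₀, rfl⟩ ?_
  rintro _ ⟨G, hG, rfl⟩
  obtain ⟨f, hf, hfG⟩ := hG.exists_isFlow (α := α) hα0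
    (Finset.subset_union_left : G.V ⊆ G.V ∪ V)
  obtain ⟨g, hg, hforest, hgf⟩ := hf.exists_forest hα0 hα1
  refine (hC _ g Finset.subset_union_right ?_ hg hforest).trans (hgf.trans hfG)
  rw [Finset.coe_union]
  exact Set.union_subset hG.2.1 hVX

/-- The flow sending mass from `x` straight to every atom of `b`. -/
lemma isFlow_star {V : Finset (Pt m)} {x : Pt m} (hx : x ∈ V) {M : ℝ} (hb : b.support ⊆ V)
    (hM : ∑ u ∈ V, b u = M) :
    IsFlow V (fun u => Finsupp.single x M u - b u) (fun u v => ∑ z ∈ V, b z * arc x z u v) where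
  antisymm u v := by
    rw [← Finset.sum_neg_distrib]
    refine Finset.sum_congr rfl fun z hz => ?_
    rw [(isFlow_arc hx hz).antisymm u v, mul_neg]
  mem_left {u v} h := by
    obtain ⟨z, hz, hne⟩ := Finset.exists_ne_zero_of_sum_ne_zero h
    exact (isFlow_arc hx hz).mem_left (right_ne_zero_of_mul hne)
  div_eq u := by
    rw [Finset.sum_comm]
    have h1 : ∀ z ∈ V, ∑ v ∈ V, b z * arc x z u v
        = b z * (if u = x then 1 else 0) - (if u = z then b z else 0) := fun z hz => by
      rw [← Finset.mul_sum, (isFlow_arc hx hz).div_eq u]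
      split_ifs <;> ring
    rw [Finset.sum_congr rfl h1, Finset.sum_sub_distrib, ← Finset.sum_mul, hM, Finset.sum_ite_eq,
      Finsupp.single_apply]
    by_cases hu : u ∈ V
    · simp [hu, eq_comm]
    · have : b u = 0 := by
        by_contra h
        exact hu (hb (Finsupp.mem_support_iff.2 h))
      simp [hu, this, eq_comm]

variable {V : Finset (Pt m)} {x z y : Pt m} {M ε η R : ℝ}

lemma support_single_subset (hx : x ∈ V) (t : ℝ) : (Finsupp.single x t).support ⊆ V :=
  Finsupp.support_single_subset.trans (Finset.singleton_subset_iff.2 hx)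

/-- Removing demand `ε` at `y` saves at least the marginal cost of `ε` at total mass `M` along
the distance from the source. -/
lemma dCost_sub_single_le (hα0 : 0 ≤ α) (hα1 : α ≤ 1) (hVX : ↑V ⊆ X) (hx : x ∈ V) (hy : y ∈ V)
    (hb : b.support ⊆ V) (hb0 : ∀ u, 0 ≤ b u) (hM : ∑ u ∈ V, b u = M) (hε : 0 < ε)
    (hεy : ε ≤ b y) :
    dCost X α (Finsupp.single x (M - ε)) (b - Finsupp.single y ε)
      ≤ dCost X α (Finsupp.single x M) b - (posPow α M - posPow α (M - ε)) * dist x y := by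
  rw [le_sub_iff_add_le]
  refine le_dCost hα0 hα1 hVX (support_single_subset hx M) hb (isFlow_star hx hb hM) ?_
  intro W f hVW hWX hf hforest
  have hbW : b.support ⊆ W := hb.trans hVW
  have hMW : ∑ u ∈ W, b u = M := by
    rw [← hM]
    refine (Finset.sum_subset hVW fun u _ hu => ?_).symm
    by_contra h
    exact hu (hb (Finsupp.mem_support_iff.2 h))
  obtain ⟨L, hL, hflow, hlen, hbound⟩ := hf.exists_path hforest (x := x) (y := y) (M := M) (b := b)
    (fun u => by simp [Finsupp.single_apply, eq_comm]) hb0 hMW (hVW hy) (hε.trans_le hεy)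
  have hMε : ε ≤ M := hεy.trans
    (hMW ▸ Finset.single_le_sum (f := b) (fun u _ => hb0 u) (hVW hy))
  have hcost := hf.flowCost_add_arcs_le (α := α) hL (t := -ε)
    (κ := -(posPow α M - posPow α (M - ε))) fun e he => by
      obtain ⟨h1, h2⟩ := hbound e he
      refine ⟨by linarith, by rw [abs_neg, abs_of_pos hε]; linarith, ?_⟩
      have := posPow_increment_anti hα0 hα1 (s := f e.1 e.2 - ε) (t := M - ε) (ε := ε)
        (by linarith) (by linarith) hε.le
      simp only [sub_add_cancel] at this
      rw [← sub_eq_add_neg]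
      linarith
  have hnew : dCost X α (Finsupp.single x (M - ε)) (b - Finsupp.single y ε)
      ≤ flowCost α W (fun u v => f u v + -ε * arcs L u v) := by
    refine dCost_le_flowCost hα0 hα1 hWX (support_single_subset (hVW hx) _) ?_ ?_
    · exact Finsupp.support_sub.trans
        (Finset.union_subset hbW (support_single_subset (hVW hy) _))
    · convert hf.add (hflow.smul (-ε)) using 2 with u
      simp only [Finsupp.sub_apply, Finsupp.single_apply, eq_comm (a := u)]
      split_ifs <;> ring
  have hκ : 0 ≤ posPow α M - posPow α (M - ε) :=
    sub_nonneg.2 (posPow_mono hα0 (by linarith))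
  nlinarith [mul_le_mul_of_nonneg_left hlen hκ]

/-- Adding demand `ε` at `y` by extending the route to an existing atom at `z`. -/
lemma dCost_add_single_le (hα0 : 0 ≤ α) (hα1 : α ≤ 1) (hVX : ↑V ⊆ X) (hx : x ∈ V) (hz : z ∈ V)
    (hy : y ∈ V) (hb : b.support ⊆ V) (hb0 : ∀ u, 0 ≤ b u) (hM : ∑ u ∈ V, b u = M) (hε : 0 < ε)
    (hεη : ε ≤ η) (hηz : η ≤ b z) (hR0 : 0 ≤ R)
    (hR : posPow α (η + ε) - posPow α η = R * (posPow α M - posPow α (M - ε))) :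
    dCost X α (Finsupp.single x (M + ε)) (b + Finsupp.single y ε)
      ≤ dCost X α (Finsupp.single x M) b + ε ^ α * dist z y + R * (ε ^ α * dist x z) := by
  set d := dCost X α (Finsupp.single x M) b with hd
  set d' := dCost X α (Finsupp.single x (M + ε)) (b + Finsupp.single y ε)
  suffices h : (d' - ε ^ α * dist z y - R * (ε ^ α * dist x z) + R * d) / (1 + R) ≤ d by
    rw [div_le_iff₀ (by linarith)] at h
    linarith
  conv_rhs => rw [hd]
  refine le_dCost hα0 hα1 hVX (support_single_subset hx M) hb (isFlow_star hx hb hM) ?_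
  intro W f hVW hWX hf hforest
  have hbW : b.support ⊆ W := hb.trans hVW
  have hMW : ∑ u ∈ W, b u = M := by
    rw [← hM]
    refine (Finset.sum_subset hVW fun u _ hu => ?_).symm
    by_contra h
    exact hu (hb (Finsupp.mem_support_iff.2 h))
  obtain ⟨L, hL, hflow, -, hbound⟩ := hf.exists_path hforest (x := x) (y := z) (M := M) (b := b)
    (fun u => by simp [Finsupp.single_apply, eq_comm]) hb0 hMW (hVW hz) (by linarith)
  set len := (L.map fun e => dist e.1 e.2).sum
  have hup := hf.flowCost_add_arcs_le (α := α) hL (t := ε)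
    (κ := posPow α (η + ε) - posPow α η) fun e he => by
      obtain ⟨h1, h2⟩ := hbound e he
      refine ⟨by linarith, by rw [abs_of_pos hε]; linarith, ?_⟩
      have := posPow_increment_anti hα0 hα1 (s := η) (t := f e.1 e.2) (ε := ε)
        (by linarith) (by linarith) hε.le
      linarith
  have hdown := hf.flowCost_add_arcs_le (α := α) hL (t := -ε)
    (κ := -(posPow α M - posPow α (M - ε))) fun e he => by
      obtain ⟨h1, h2⟩ := hbound e he
      refine ⟨by linarith, by rw [abs_neg, abs_of_pos hε]; linarith, ?_⟩
      have := posPow_increment_anti hα0 hα1 (s := f e.1 e.2 - ε) (t := M - ε) (ε := ε)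
        (by linarith) (by linarith) hε.le
      simp only [sub_add_cancel] at this
      rw [← sub_eq_add_neg]
      linarith
  have hnew : d' ≤ flowCost α W (fun u v => f u v + ε * arcs L u v) + ε ^ α * dist z y := by
    refine le_trans (dCost_le_flowCost hα0 hα1 hWX (support_single_subset (hVW hx) _) ?_ ?_)
      ((flowCost_add_le hα0 hα1).trans
        (add_le_add_right (flowCost_smul_arc_le hα0 hε z y) _))
    · exact Finsupp.support_add.trans
        (Finset.union_subset hbW (support_single_subset (hVW hy) _))
    · convert (hf.add (hflow.smul ε)).add ((isFlow_arc (hVW hz) (hVW hy)).smul ε) using 2 with u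
      simp only [Finsupp.add_apply, Finsupp.single_apply, eq_comm (a := u)]
      split_ifs <;> ring
  have hold : d ≤ flowCost α W (fun u v => f u v + -ε * arcs L u v) + ε ^ α * dist x z := by
    refine le_trans (dCost_le_flowCost hα0 hα1 hWX (support_single_subset (hVW hx) _) hbW ?_)
      ((flowCost_add_le hα0 hα1).trans
        (add_le_add_right (flowCost_smul_arc_le hα0 hε x z) _))
    convert (hf.add (hflow.smul (-ε))).add ((isFlow_arc (hVW hx) (hVW hz)).smul ε) using 2 with u
    ring
  rw [div_le_iff₀ (by linarith)]
  have h1 : d ≤ flowCost α W f - (posPow α M - posPow α (M - ε)) * len + ε ^ α * dist x z := by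
    linarith
  rw [hR] at hup
  have h2 := mul_le_mul_of_nonneg_left h1 hR0
  linarith

end TransportPath

lemma rpow_mul_rho {α σ ε : ℝ} (hε : 0 < ε) (hσ : ε ≤ σ) :
    ε ^ α * rho α σ ε = NetFlow.posPow α σ - NetFlow.posPow α (σ - ε) := by
  rcases hσ.eq_or_lt with rfl | h
  · rw [rho, if_pos rfl, NetFlow.posPow_of_pos hε, NetFlow.posPow_of_nonpos (sub_self _).le]
    ring
  · have h1 : 0 < σ - ε := by linarith
    rw [rho, if_neg h.ne', NetFlow.posPow_of_pos (hε.trans h), NetFlow.posPow_of_pos h1,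
      show σ / ε - 1 = (σ - ε) / ε by field_simp, Real.div_rpow (by linarith) hε.le,
      Real.div_rpow h1.le hε.le]
    have : ε ^ α ≠ 0 := (Real.rpow_pos_of_pos hε α).ne'
    field_simp

lemma rho_nonneg {α σ ε : ℝ} (hα0 : 0 ≤ α) (hε : 0 < ε) (hσ : ε ≤ σ) : 0 ≤ rho α σ ε := by
  have h := rpow_mul_rho (α := α) hε hσ
  have h1 : 0 ≤ ε ^ α * rho α σ ε :=
    h ▸ sub_nonneg.2 (NetFlow.posPow_mono hα0 (by linarith))
  exact nonneg_of_mul_nonneg_right h1 (Real.rpow_pos_of_pos hε α)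

lemma rho_pos {α σ ε : ℝ} (hα0 : 0 < α) (hε : 0 < ε) (hσ : ε ≤ σ) : 0 < rho α σ ε := by
  unfold rho
  split_ifs with h
  · exact one_pos
  · have : 1 ≤ σ / ε := (one_le_div hε).2 hσ
    exact sub_pos.2 (Real.rpow_lt_rpow (by linarith) (by linarith) hα0)

section Assignment

variable {m k ℓ : ℕ} (y : Fin ℓ → Pt m) {n : Fin ℓ → ℝ} (S : Fin ℓ → Fin k)

lemma bPart_nonneg (hn : ∀ j, 0 < n j) (i : Fin k) (u : Pt m) : 0 ≤ bPart y n S i u := by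
  rw [bPart, Finsupp.finsetSum_apply]
  refine Finset.sum_nonneg fun j _ => ?_
  rw [Finsupp.single_apply]
  split_ifs
  · exact (hn j).le
  · exact le_rfl

lemma le_bPart (hn : ∀ j, 0 < n j) (j : Fin ℓ) : n j ≤ bPart y n S (S j) (y j) := by
  rw [bPart, Finsupp.finsetSum_apply]
  have h := Finset.single_le_sum (s := Finset.univ.filter fun j' => S j' = S j)
    (f := fun j' => (Finsupp.single (y j') (n j')) (y j))
    (fun j' _ => by
      rw [Finsupp.single_apply]
      split_ifs
      · exact (hn j').le
      · exact le_rfl) (Finset.mem_filter.2 ⟨Finset.mem_univ j, rfl⟩)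
  simpa using h

lemma support_bPart_subset {V : Finset (Pt m)} (hV : ∀ j, y j ∈ V) (i : Fin k) :
    (bPart y n S i).support ⊆ V := by
  intro u hu
  rw [Finsupp.mem_support_iff, bPart, Finsupp.finsetSum_apply] at hu
  obtain ⟨j, -, hj⟩ := Finset.exists_ne_zero_of_sum_ne_zero hu
  rw [Finsupp.single_apply] at hj
  split_ifs at hj with h
  · exact h ▸ hV j
  · exact absurd rfl hj

lemma sum_bPart {V : Finset (Pt m)} (hV : ∀ j, y j ∈ V) (i : Fin k) :
    ∑ u ∈ V, bPart y n S i u = mB n S i := by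
  simp only [bPart, Finsupp.finsetSum_apply]
  rw [Finset.sum_comm]
  refine Finset.sum_congr rfl fun j _ => ?_
  simp [Finsupp.single_apply, hV j]

variable {S}

/-- Reassigning `j` to `t` changes sums over the fibre of `i` only if `i` is `S j` or `t`. -/
lemma sum_fiber_update {A : Type*} [AddCommGroup A] (F : Fin ℓ → A) (j : Fin ℓ) (t i : Fin k) :
    ∑ j' with Function.update S j t j' = i, F j'
      = ∑ j' with S j' = i, F j' + (if t = i then F j else 0) - (if S j = i then F j else 0) := by
  simp only [Finset.sum_filter]
  rw [← Finset.add_sum_erase _ _ (Finset.mem_univ j),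
    ← Finset.add_sum_erase (f := fun j' => if S j' = i then F j' else 0) _ (Finset.mem_univ j)]
  have h : ∀ j' ∈ Finset.univ.erase j, (if Function.update S j t j' = i then F j' else 0)
      = if S j' = i then F j' else 0 := fun j' hj' => by
    rw [Function.update_of_ne (Finset.ne_of_mem_erase hj')]
  rw [Finset.sum_congr rfl h, Function.update_self]
  abel

lemma mB_update (j : Fin ℓ) (t i : Fin k) :
    mB n (Function.update S j t) i
      = mB n S i + (if t = i then n j else 0) - (if S j = i then n j else 0) :=
  sum_fiber_update _ j t i

lemma bPart_update (j : Fin ℓ) (t i : Fin k) :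
    bPart y n (Function.update S j t) i
      = bPart y n S i + (if t = i then Finsupp.single (y j) (n j) else 0)
        - (if S j = i then Finsupp.single (y j) (n j) else 0) :=
  sum_fiber_update _ j t i

end Assignment

/-- If household `h` (with `n_j ≤ n_h`) is assigned to
`s* ≠ s` and `‖y_j − y_h‖ + (ρ_α(n_h + n_j, n_j)/ρ_α(m(b_(s*)), n_j)) ‖y_h − x_(s*)‖
< ρ_α(m(b_s), n_j) ‖y_j − x_s‖`, then `S(j) ≠ s`. -/
theorem stmt_12 {m k ℓ : ℕ} (X : Set (Pt m)) (hXc : IsCompact X) (hXconv : Convex ℝ X)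
    (α : ℝ) (hα0 : 0 ≤ α) (hα1 : α < 1)
    (x : Fin k → Pt m) (hxinj : Function.Injective x) (hxX : ∀ i, x i ∈ X)
    (y : Fin ℓ → Pt m) (hyinj : Function.Injective y) (hyX : ∀ j, y j ∈ X)
    (n : Fin ℓ → ℝ) (hn : ∀ j, 0 < n j) (hnsum : ∑ j, n j = 1)
    (hk : 2 ≤ k) (S : Fin ℓ → Fin k) (hS : IsOptimalAssign X α x y n S)
    (h j : Fin ℓ) (hhj : h ≠ j) (hnjh : n j ≤ n h)
    (s sstar : Fin k) (hss : sstar ≠ s) (hSh : S h = sstar)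
    (hms : n j ≤ mB n S s)
    (hineq : ‖y j - y h‖ +
        (rho α (n h + n j) (n j) / rho α (mB n S sstar) (n j)) * ‖y h - x sstar‖ <
          rho α (mB n S s) (n j) * ‖y j - x s‖) :
    S j ≠ s := by
  rintro rfl
  set ε := n j
  have hε : 0 < ε := hn j
  have hεα : 0 < ε ^ α := Real.rpow_pos_of_pos hε α
  subst hSh
  set V : Finset (Pt m) := Finset.univ.image x ∪ Finset.univ.image y
  have hxV : ∀ i, x i ∈ V := fun i =>
    Finset.mem_union_left _ (Finset.mem_image_of_mem x (Finset.mem_univ i))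
  have hyV : ∀ i, y i ∈ V := fun i =>
    Finset.mem_union_right _ (Finset.mem_image_of_mem y (Finset.mem_univ i))
  have hVX : ↑V ⊆ X := by
    intro u hu
    rcases Finset.mem_union.1 (Finset.mem_coe.1 hu) with hu | hu
    · obtain ⟨i, -, rfl⟩ := Finset.mem_image.1 hu
      exact hxX i
    · obtain ⟨i, -, rfl⟩ := Finset.mem_image.1 hu
      exact hyX i
  have hmsstar : ε ≤ mB n S (S h) := by
    rw [← sum_bPart y S hyV]
    exact hnjh.trans ((le_bPart y S hn h).trans
      (Finset.single_le_sum (fun u _ => bPart_nonneg y S hn _ u) (hyV h)))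
  have hρ := rpow_mul_rho (α := α) hε hms
  have hρstar := rpow_mul_rho (α := α) hε hmsstar
  have hρh := rpow_mul_rho (α := α) (σ := n h + ε) hε (by linarith)
  have hρstar0 := rho_nonneg hα0 hε hmsstar
  have hρh0 := rho_nonneg (σ := n h + ε) hα0 hε (by linarith)
  set R := rho α (n h + ε) ε / rho α (mB n S (S h)) ε with hRdef
  have hR0 : 0 ≤ R := div_nonneg hρh0 hρstar0
  have hR : rho α (n h + ε) ε = R * rho α (mB n S (S h)) ε := by
    rcases hα0.eq_or_lt with rfl | hα
    · have h1 : n h + ε ≠ ε := by linarith [hn h]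
      have h2 : rho 0 (n h + ε) ε = 0 := by simp [rho, h1]
      rw [hRdef, h2]
      simp
    · exact (div_mul_cancel₀ _ (rho_pos hα hε hmsstar).ne').symm
  have hremove := dCost_sub_single_le hα0 hα1.le hVX (hxV (S j)) (hyV j)
    (support_bPart_subset y S hyV (S j)) (bPart_nonneg y S hn (S j)) (sum_bPart y S hyV (S j)) hε
    (le_bPart y S hn j)
  have hinsert := dCost_add_single_le (R := R) hα0 hα1.le hVX (hxV (S h)) (hyV h) (hyV j)
    (support_bPart_subset y S hyV (S h)) (bPart_nonneg y S hn (S h)) (sum_bPart y S hyV (S h)) hε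
    hnjh (le_bPart y S hn h) hR0 (by
      rw [add_sub_cancel_right] at hρh
      rw [← hρstar, ← hρh, hR]
      ring)
  rw [← hρ] at hremove
  have hopt := hS (Function.update S j (S h))
  unfold Ealpha at hopt
  have hsplit : ∀ F : Fin k → ℝ,
      ∑ i, F i = F (S j) + (F (S h) + ∑ i ∈ (Finset.univ.erase (S j)).erase (S h), F i) := by
    intro F
    rw [Finset.add_sum_erase _ _ (Finset.mem_erase.2 ⟨hss, Finset.mem_univ _⟩),
      Finset.add_sum_erase _ _ (Finset.mem_univ _)]
  rw [hsplit, hsplit (fun i => dCost X α (Finsupp.single (x i) (mB n (Function.update S j (S h)) i))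
    (bPart y n (Function.update S j (S h)) i))] at hopt
  have hrest : ∑ i ∈ (Finset.univ.erase (S j)).erase (S h),
      dCost X α (Finsupp.single (x i) (mB n (Function.update S j (S h)) i))
        (bPart y n (Function.update S j (S h)) i)
      = ∑ i ∈ (Finset.univ.erase (S j)).erase (S h),
        dCost X α (Finsupp.single (x i) (mB n S i)) (bPart y n S i) := by
    refine Finset.sum_congr rfl fun i hi => ?_
    obtain ⟨hi1, hi2⟩ := Finset.mem_erase.1 hi
    have hi3 := Finset.ne_of_mem_erase hi2
    rw [mB_update, bPart_update, if_neg hi1.symm, if_neg hi3.symm, if_neg hi1.symm,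
      if_neg hi3.symm]
    simp only [add_zero, sub_zero]
  rw [hrest] at hopt
  simp only [mB_update, bPart_update, if_neg hss, if_neg hss.symm, if_true, add_zero, sub_zero]
    at hopt
  rw [← dist_eq_norm, ← dist_eq_norm, ← dist_eq_norm, dist_comm (y j) (y h),
    dist_comm (y h) (x (S h)), dist_comm (y j) (x (S j))] at hineq
  have := mul_lt_mul_of_pos_left hineq hεα
  linarith

end
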